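/- Let l ≥ 32 be an integer and let i be the least integer with 3^i ≥ l. Define m = 3 if l ≤ 3^i < 9l/8 or 3l/2 ≤ 3^i < 27l/16; m = 4 if 9l/8 ≤ 3^i < 27l/20, or 27l/16 ≤ 3^i < 9l/5, or 9l/4 ≤ 3^i < 27l/10; and m = 5 if 27l/20 ≤ 3^i < 3l/2, or 9l/5 ≤ 3^i < 9l/4, or 27l/10 ≤ 3^i < 3l. Then: (a) there exists an optimal covering of l whose maximal element is m; (b) no optimal covering of l contains an element greater than m. Consequently the minimal possible number of base-level nodes, ⌈l/x⌉ where x ranges over the maximal elements of optimal coverings of l, equals ⌈l/m⌉. -/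

import Mathlib

/-- Ceiling division of natural numbers: `⌈a / b⌉`. -/
def ceilDiv (a b : ℕ) : ℕ := (a + b - 1) / b

/-- A multiset `S` of integers, each at least 2, is a covering of `l`
if the product of its elements is at least `l`. -/
def Covering (l : ℕ) (S : Multiset ℕ) : Prop :=
  (∀ x ∈ S, 2 ≤ x) ∧ l ≤ S.prod

/-- A covering of `l` is optimal if its cost (the sum of its elements) is
minimal among all coverings of `l`. -/
def OptimalCovering (l : ℕ) (S : Multiset ℕ) : Prop :=
  Covering l S ∧ ∀ T : Multiset ℕ, Covering l T → S.sum ≤ T.sum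

/-- The maximal base-level arity `m` prescribed by the case analysis:
`m = 3` if `3^i ∈ [l, 9l/8) ∪ [3l/2, 27l/16)`,
`m = 4` if `3^i ∈ [9l/8, 27l/20) ∪ [27l/16, 9l/5) ∪ [9l/4, 27l/10)`,
`m = 5` if `3^i ∈ [27l/20, 3l/2) ∪ [9l/5, 9l/4) ∪ [27l/10, 3l)`
(inequalities between rationals written in integer form). -/
def maxArity (l i : ℕ) : ℕ :=
  if (8 * 3 ^ i < 9 * l) ∨ (3 * l ≤ 2 * 3 ^ i ∧ 16 * 3 ^ i < 27 * l) then 3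
  else if (9 * l ≤ 8 * 3 ^ i ∧ 20 * 3 ^ i < 27 * l) ∨
          (27 * l ≤ 16 * 3 ^ i ∧ 5 * 3 ^ i < 9 * l) ∨
          (9 * l ≤ 4 * 3 ^ i ∧ 10 * 3 ^ i < 27 * l) then 4
  else 5

/-- The largest product of a multiset of natural numbers with sum `n`. -/
def maxProd : ℕ → ℕ
  | 0 => 1
  | 1 => 1
  | 2 => 2
  | 3 => 3
  | 4 => 4
  | n + 5 => 3 * maxProd (n + 2)

theorem maxProd_le_succ (n : ℕ) : maxProd n ≤ maxProd (n + 1) := by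
  induction n using maxProd.induct with
  | case6 n ih =>
    rw [show n + 5 + 1 = (n + 1) + 5 by ring, maxProd, maxProd]
    rw [show n + 2 + 1 = n + 1 + 2 by ring] at ih
    omega
  | _ => simp [maxProd]

theorem maxProd_mono : Monotone maxProd := monotone_nat_of_le_succ maxProd_le_succ

theorem two_mul_maxProd_le (n : ℕ) : 2 * maxProd n ≤ maxProd (n + 2) := by
  induction n using maxProd.induct with
  | case6 n ih =>
    rw [show n + 5 + 2 = (n + 2) + 5 by ring, maxProd, maxProd]
    omega
  | _ => simp [maxProd]

theorem three_mul_maxProd_le (n : ℕ) : 3 * maxProd n ≤ maxProd (n + 3) := by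
  match n with
  | 0 | 1 => simp [maxProd]
  | n + 2 => rw [show n + 2 + 3 = n + 5 by ring, maxProd]

theorem mul_maxProd_le (x n : ℕ) : x * maxProd n ≤ maxProd (x + n) := by
  induction x using Nat.strong_induction_on with
  | _ x ih =>
    have h1 := maxProd_le_succ n
    have h2 := two_mul_maxProd_le n
    have h3 := three_mul_maxProd_le n
    have h4 := two_mul_maxProd_le (n + 2)
    match x with
    | 0 => simp
    | 1 => rw [add_comm]; omega
    | 2 => rw [add_comm]; omega
    | 3 => rw [add_comm]; omega
    | 4 => rw [add_comm 4 n]; simp only [add_assoc, Nat.reduceAdd] at h4; omega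
    | y + 5 =>
      have h := ih (y + 2) (by omega)
      have h5 := three_mul_maxProd_le (y + 2 + n)
      rw [show y + 2 + n + 3 = y + 5 + n by ring] at h5
      nlinarith

theorem mul_maxProd_le_two_mul (a n : ℕ) :
    (a + 6) * maxProd n ≤ 2 * maxProd (a + n + 3) := by
  induction a using Nat.strong_induction_on with
  | _ a ih =>
    match a with
    | 0 =>
      have h := three_mul_maxProd_le n
      rw [zero_add, zero_add]; omega
    | 1 =>
      have h := mul_maxProd_le 4 n
      rw [show 1 + n + 3 = 4 + n by ring]; omega
    | 2 =>
      have h := two_mul_maxProd_le n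
      rw [show 2 + n + 3 = n + 5 by ring, maxProd]; omega
    | b + 3 =>
      have h := ih b (by omega)
      have h5 := three_mul_maxProd_le (b + n + 3)
      rw [show b + n + 3 + 3 = b + 3 + n + 3 by ring] at h5
      nlinarith

theorem prod_le_maxProd (S : Multiset ℕ) : S.prod ≤ maxProd S.sum := by
  induction S using Multiset.induction_on with
  | empty => simp [maxProd]
  | cons x S ih =>
    rw [Multiset.prod_cons, Multiset.sum_cons]
    exact (Nat.mul_le_mul_left x ih).trans (mul_maxProd_le x _)

theorem maxProd_three_mul_add_two (k : ℕ) : maxProd (3 * k + 2) = 2 * 3 ^ k := by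
  induction k with
  | zero => simp [maxProd]
  | succ k ih => rw [show 3 * (k + 1) + 2 = 3 * k + 5 by ring, maxProd, ih]; ring

theorem maxProd_three_mul_add_three (k : ℕ) : maxProd (3 * k + 3) = 3 * 3 ^ k := by
  induction k with
  | zero => simp [maxProd]
  | succ k ih =>
    rw [show 3 * (k + 1) + 3 = 3 * k + 1 + 5 by ring, maxProd,
      show 3 * k + 1 + 2 = 3 * k + 3 by ring, ih]
    ring

theorem maxProd_three_mul_add_four (k : ℕ) : maxProd (3 * k + 4) = 4 * 3 ^ k := by
  induction k with
  | zero => simp [maxProd]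
  | succ k ih =>
    rw [show 3 * (k + 1) + 4 = 3 * k + 2 + 5 by ring, maxProd,
      show 3 * k + 2 + 2 = 3 * k + 4 by ring, ih]
    ring

/-- Values of `maxProd` at the sums just below `3 * (k + 4)`. -/
theorem maxProd_values (k : ℕ) :
    maxProd (3 * k + 5) = 6 * 3 ^ k ∧ maxProd (3 * k + 6) = 9 * 3 ^ k ∧
    maxProd (3 * k + 7) = 12 * 3 ^ k ∧ maxProd (3 * k + 8) = 18 * 3 ^ k ∧
    maxProd (3 * k + 9) = 27 * 3 ^ k ∧ maxProd (3 * k + 10) = 36 * 3 ^ k ∧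
    maxProd (3 * k + 11) = 54 * 3 ^ k := by
  refine ⟨?_, ?_, ?_, ?_, ?_, ?_, ?_⟩
  · rw [show 3 * k + 5 = 3 * (k + 1) + 2 by ring, maxProd_three_mul_add_two]; ring
  · rw [show 3 * k + 6 = 3 * (k + 1) + 3 by ring, maxProd_three_mul_add_three]; ring
  · rw [show 3 * k + 7 = 3 * (k + 1) + 4 by ring, maxProd_three_mul_add_four]; ring
  · rw [show 3 * k + 8 = 3 * (k + 2) + 2 by ring, maxProd_three_mul_add_two]; ring
  · rw [show 3 * k + 9 = 3 * (k + 2) + 3 by ring, maxProd_three_mul_add_three]; ring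
  · rw [show 3 * k + 10 = 3 * (k + 2) + 4 by ring, maxProd_three_mul_add_four]; ring
  · rw [show 3 * k + 11 = 3 * (k + 3) + 2 by ring, maxProd_three_mul_add_two]; ring

theorem ceilDiv_anti {l x m : ℕ} (hx : 0 < x) (h : x ≤ m) : ceilDiv l m ≤ ceilDiv l x := by
  change l ⌈/⌉ m ≤ l ⌈/⌉ x
  rw [ceilDiv_le_iff_le_mul (hx.trans_le h)]
  exact (le_smul_ceilDiv hx).trans (Nat.mul_le_mul_right _ h)

theorem optimal_of_witness {l s m : ℕ} (W : Multiset ℕ) (hW : Covering l W)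
    (hsum : W.sum = s + 1) (hs : maxProd s < l) (hmW : m ∈ W) (hle : ∀ x ∈ W, x ≤ m)
    (hgt : ∀ x n, m < x → x + n = s + 1 → x * maxProd n < l) :
    (∃ S : Multiset ℕ, OptimalCovering l S ∧ m ∈ S ∧ ∀ x ∈ S, x ≤ m) ∧
    (∀ S : Multiset ℕ, OptimalCovering l S → ∀ x ∈ S, x ≤ m) ∧
    IsLeast {n : ℕ | ∃ (S : Multiset ℕ) (x : ℕ), OptimalCovering l S ∧ x ∈ S ∧
        (∀ y ∈ S, y ≤ x) ∧ n = ceilDiv l x}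
      (ceilDiv l m) := by
  have hlow : ∀ T : Multiset ℕ, Covering l T → s + 1 ≤ T.sum := by
    intro T hT
    by_contra! h
    have h1 := maxProd_mono (Nat.lt_succ_iff.mp h)
    have h2 := prod_le_maxProd T
    have h3 := hT.2
    omega
  have hopt : OptimalCovering l W := ⟨hW, fun T hT => hsum ▸ hlow T hT⟩
  have hmax : ∀ S : Multiset ℕ, OptimalCovering l S → ∀ x ∈ S, x ≤ m := by
    intro S hS x hx
    by_contra! h
    have hSsum : S.sum = s + 1 := le_antisymm (hsum ▸ hS.2 W hW) (hlow S hS.1)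
    obtain ⟨T, rfl⟩ := Multiset.exists_cons_of_mem hx
    rw [Multiset.sum_cons] at hSsum
    have h1 := hgt x T.sum h hSsum
    have h2 := hS.1.2
    rw [Multiset.prod_cons] at h2
    have h3 := Nat.mul_le_mul_left x (prod_le_maxProd T)
    omega
  refine ⟨⟨W, hopt, hmW, hle⟩, hmax, ⟨W, m, hopt, hmW, hle, rfl⟩, ?_⟩
  rintro n ⟨S, x, hS, hx, -, rfl⟩
  exact ceilDiv_anti (by have := hS.1.1 x hx; omega) (hmax S hS x hx)

/-- Bounding products with an element exceeding `m ≥ 3` reduces to the elements `4`, `5`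
and a uniform bound for elements at least `6`. -/
theorem mul_maxProd_lt {l s m : ℕ} (hm : 3 ≤ m) (h4 : m < 4 → 4 * maxProd (s + 2) < l)
    (h5 : m < 5 → 5 * maxProd (s + 1) < l) (h6 : 2 * maxProd (s + 3) < l) (x n : ℕ)
    (hx : m < x) (hn : x + n = s + 6) : x * maxProd n < l := by
  by_cases hx4 : x = 4
  · subst hx4
    obtain rfl : n = s + 2 := by omega
    exact h4 hx
  by_cases hx5 : x = 5
  · subst hx5
    obtain rfl : n = s + 1 := by omega
    exact h5 hx
  obtain ⟨a, rfl⟩ : ∃ a, x = a + 6 := ⟨x - 6, by omega⟩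
  refine (mul_maxProd_le_two_mul a n).trans_lt ?_
  rwa [show a + n + 3 = s + 3 by omega]

/-- If `A` together with `k + t` threes covers `l` at cost `s + 6` and the stated bounds hold, then
the maximal element `m` of `A` is the largest element occurring in an optimal covering of `l`. -/
theorem optimal_of_parts {l k s t m : ℕ} (A : Multiset ℕ) (hA : ∀ x ∈ A, 2 ≤ x ∧ x ≤ m)
    (hm : 3 ≤ m) (hmA : m ∈ A) (hprod : l ≤ A.prod * (3 ^ t * 3 ^ k))
    (hsum : A.sum + 3 * (k + t) = s + 6) (hs : maxProd (s + 5) < l)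
    (h4 : m < 4 → 4 * maxProd (s + 2) < l)
    (h5 : m < 5 → 5 * maxProd (s + 1) < l) (h6 : 2 * maxProd (s + 3) < l) :
    (∃ S : Multiset ℕ, OptimalCovering l S ∧ m ∈ S ∧ ∀ x ∈ S, x ≤ m) ∧
    (∀ S : Multiset ℕ, OptimalCovering l S → ∀ x ∈ S, x ≤ m) ∧
    IsLeast {n : ℕ | ∃ (S : Multiset ℕ) (x : ℕ), OptimalCovering l S ∧ x ∈ S ∧
        (∀ y ∈ S, y ≤ x) ∧ n = ceilDiv l x}
      (ceilDiv l m) := by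
  have hmem : ∀ x ∈ A + Multiset.replicate (k + t) 3, 2 ≤ x ∧ x ≤ m := by
    intro x hx
    rcases Multiset.mem_add.mp hx with h | h
    · exact hA x h
    · rw [Multiset.eq_of_mem_replicate h]; omega
  refine optimal_of_witness (s := s + 5) (A + Multiset.replicate (k + t) 3)
    ⟨fun x hx => (hmem x hx).1, ?_⟩ ?_ hs (Multiset.mem_add.mpr (Or.inl hmA))
    (fun x hx => (hmem x hx).2) (mul_maxProd_lt hm h4 h5 h6)
  · rw [Multiset.prod_add, Multiset.prod_replicate, add_comm k t, pow_add]
    exact hprod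
  · rw [Multiset.sum_add, Multiset.sum_replicate, smul_eq_mul]
    omega

/-- For `l ≥ 32` and `i` the least integer with `3^i ≥ l`, with `m = maxArity l i`:
(a) some optimal covering of `l` has maximal element `m`; (b) no optimal covering of
`l` contains an element greater than `m`; consequently the least possible number
`⌈l/x⌉` of base-level nodes, over maximal elements `x` of optimal coverings of `l`,
is `⌈l/m⌉`. -/
theorem optimal_max_arity
    (l i : ℕ) (hl : 32 ≤ l) (hi : l ≤ 3 ^ i) (hmin : ∀ j : ℕ, l ≤ 3 ^ j → i ≤ j) :
    (∃ S : Multiset ℕ, OptimalCovering l S ∧ maxArity l i ∈ S ∧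
        ∀ x ∈ S, x ≤ maxArity l i) ∧
    (∀ S : Multiset ℕ, OptimalCovering l S → ∀ x ∈ S, x ≤ maxArity l i) ∧
    IsLeast {n : ℕ | ∃ (S : Multiset ℕ) (x : ℕ), OptimalCovering l S ∧ x ∈ S ∧
        (∀ y ∈ S, y ≤ x) ∧ n = ceilDiv l x}
      (ceilDiv l (maxArity l i)) := by
  have hi4 : 4 ≤ i := by
    by_contra! h
    have := Nat.pow_le_pow_right (n := 3) (by norm_num) (Nat.lt_succ_iff.mp h)
    omega
  obtain ⟨k, rfl⟩ := Nat.exists_eq_add_of_le' hi4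
  have hlow : 3 ^ (k + 3) < l := by
    by_contra! h
    have := hmin _ h
    omega
  obtain ⟨v5, v6, v7, v8, v9, v10, v11⟩ := maxProd_values k
  have e4 : 3 ^ (k + 4) = 81 * 3 ^ k := by ring
  have e3 : 3 ^ (k + 3) = 27 * 3 ^ k := by ring
  rw [e4] at hi
  rw [e3] at hlow
  simp only [maxArity, e4]
  clear hmin e4 e3
  split_ifs with c3 c4
  · by_cases h : 54 * 3 ^ k < l
    · refine optimal_of_parts (k := k) (s := 3 * k + 6) (t := 3) {3}
        ?_ ?_ ?_ ?_ ?_ ?_ ?_ ?_ ?_ <;>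
        simp [add_assoc, *] <;> omega
    · refine optimal_of_parts (k := k) (s := 3 * k + 5) (t := 2) {3, 2}
        ?_ ?_ ?_ ?_ ?_ ?_ ?_ ?_ ?_ <;>
        simp [add_assoc, *] <;> omega
  · by_cases h : 54 * 3 ^ k < l
    · refine optimal_of_parts (k := k) (s := 3 * k + 6) (t := 2) {4, 2}
        ?_ ?_ ?_ ?_ ?_ ?_ ?_ ?_ ?_ <;>
        simp [add_assoc, *] <;> omega
    · by_cases h' : 36 * 3 ^ k < l
      · refine optimal_of_parts (k := k) (s := 3 * k + 5) (t := 1) {4, 4}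
          ?_ ?_ ?_ ?_ ?_ ?_ ?_ ?_ ?_ <;>
          simp [add_assoc, *] <;> omega
      · refine optimal_of_parts (k := k) (s := 3 * k + 4) (t := 2) {4}
          ?_ ?_ ?_ ?_ ?_ ?_ ?_ ?_ ?_ <;>
          simp [add_assoc, *] <;> omega
  · by_cases h : 54 * 3 ^ k < l
    · refine optimal_of_parts (k := k) (s := 3 * k + 6) (t := 1) {5, 4}
        ?_ ?_ ?_ ?_ ?_ ?_ ?_ ?_ ?_ <;>
        simp [add_assoc, *] <;> omega
    · by_cases h' : 36 * 3 ^ k < l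
      · refine optimal_of_parts (k := k) (s := 3 * k + 5) (t := 2) {5}
          ?_ ?_ ?_ ?_ ?_ ?_ ?_ ?_ ?_ <;>
          simp [add_assoc, *] <;> omega
      · refine optimal_of_parts (k := k) (s := 3 * k + 4) (t := 1) {5, 2}
          ?_ ?_ ?_ ?_ ?_ ?_ ?_ ?_ ?_ <;>
          simp [add_assoc, *] <;> omega
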